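/- Let X be a topological space, U an open cover of X, and x₀ ∈ X. For each loop β at x₀ whose class lies in π(U, x₀), the image of [β] under the homomorphism π₁(X, x₀) → π₁(R(X, U), x₀) induced by the natural inclusion of X-chains is trivial, where R(X, U) is the Rips complex of X with respect to U (vertices are points of X, simplices are finite subsets of members of U) and the homomorphism sends a path α to the edge path through α(0), α(δ), α(2δ), …, α(1) for δ small enough that each subinterval of length δ maps into a member of U. -/

import Mathlib

open Set

variable {X : Type*} [TopologicalSpace X]

/-- The star of a point `x` with respect to a cover: the union of all members containing `x`. -/
def ptStar (𝒞 : Set (Set X)) (x : X) : Set X := ⋃₀ {C ∈ 𝒞 | x ∈ C}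

/-- The star `St(W, 𝒞)` of a set `W`: the union of all members of `𝒞` meeting `W`. -/
def setStar (𝒞 : Set (Set X)) (W : Set X) : Set X := ⋃₀ {C ∈ 𝒞 | (C ∩ W).Nonempty}

/-- The cover `St(𝒞) = {St(C, 𝒞) : C ∈ 𝒞}`. -/
def starCover (𝒞 : Set (Set X)) : Set (Set X) := setStar 𝒞 '' 𝒞

/-- `𝒱` refines `𝒰`: every member of `𝒱` is contained in some member of `𝒰`. -/
def Refines (𝒱 𝒰 : Set (Set X)) : Prop := ∀ V ∈ 𝒱, ∃ U ∈ 𝒰, V ⊆ U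

/-- An open cover of `X`. -/
def IsOpenCover (𝒰 : Set (Set X)) : Prop := (∀ U ∈ 𝒰, IsOpen U) ∧ ⋃₀ 𝒰 = univ

/-- `𝒱` star refines `𝒰`: the cover of point stars of `𝒱` refines `𝒰`. -/
def StarRefines (𝒱 𝒰 : Set (Set X)) : Prop := ∀ x : X, ∃ U ∈ 𝒰, ptStar 𝒱 x ⊆ U

/-- The element of the fundamental group determined by a loop. -/
noncomputable def loopClass {x : X} (γ : Path x x) : FundamentalGroup X x :=
  FundamentalGroup.fromPath (X := TopCat.of X) ⟦γ⟧

/-- The subgroup `π(𝒰, x)` of `π₁(X, x)` generated by classes `[α·γ·α⁻¹]` where `α` is a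
path starting at `x` and `γ` is a loop contained in some member of `𝒰`. -/
noncomputable def piCover (𝒰 : Set (Set X)) (x : X) : Subgroup (FundamentalGroup X x) :=
  Subgroup.closure {g | ∃ (y : X) (α : Path x y) (γ : Path y y) (U : Set X),
    U ∈ 𝒰 ∧ Set.range γ ⊆ U ∧ g = loopClass ((α.trans γ).trans α.symm)}

/-- Two points lie in a common member of `𝒰`. -/
def ChainCond (𝒰 : Set (Set X)) (a b : X) : Prop := ∃ U ∈ 𝒰, a ∈ U ∧ b ∈ U

/-- A `𝒰`-chain: a nonempty finite list of points of `X` with consecutive points lying in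
a common member of `𝒰`. -/
def IsUChain (𝒰 : Set (Set X)) (l : List X) : Prop := l ≠ [] ∧ l.Chain' (ChainCond 𝒰)

/-- Elementary moves on `𝒰`-chains: inserting or deleting a vertex within a simplex of the
Rips complex `R(X, 𝒰)`, and inserting or deleting a repeated vertex. -/
inductive ChainStep (𝒰 : Set (Set X)) : List X → List X → Prop
  | insert (pre post : List X) (a y b : X) (U : Set X) (hU : U ∈ 𝒰)
      (ha : a ∈ U) (hy : y ∈ U) (hb : b ∈ U) :
      ChainStep 𝒰 (pre ++ a :: b :: post) (pre ++ a :: y :: b :: post)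
  | delete (pre post : List X) (a y b : X) (U : Set X) (hU : U ∈ 𝒰)
      (ha : a ∈ U) (hy : y ∈ U) (hb : b ∈ U) :
      ChainStep 𝒰 (pre ++ a :: y :: b :: post) (pre ++ a :: b :: post)
  | dup (pre post : List X) (a : X) :
      ChainStep 𝒰 (pre ++ a :: post) (pre ++ a :: a :: post)
  | dedup (pre post : List X) (a : X) :
      ChainStep 𝒰 (pre ++ a :: a :: post) (pre ++ a :: post)

/-- Two `𝒰`-chains are `𝒰`-homotopic when they are related by a finite sequence of
elementary moves. -/
def ChainHomotopic (𝒰 : Set (Set X)) : List X → List X → Prop :=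
  Relation.ReflTransGen (ChainStep 𝒰)

/-- `c` is a `𝒰`-chain sampling of the path `β`: it is obtained by evaluating `β` along a
partition `0 = t₀ ≤ ⋯ ≤ tₙ = 1` fine enough that each subinterval maps into a member of `𝒰`. -/
def Samples (𝒰 : Set (Set X)) {x y : X} (β : Path x y) (c : List X) : Prop :=
  ∃ (n : ℕ) (t : Fin (n + 1) → unitInterval), Monotone t ∧ t 0 = 0 ∧ t (Fin.last n) = 1 ∧
    (∀ i : Fin n, ∃ U ∈ 𝒰, β '' Set.Icc (t i.castSucc) (t i.succ) ⊆ U) ∧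
    c = List.ofFn fun i => β (t i)

namespace ChainHomotopic

variable {Y : Type*} {𝒰 : Set (Set Y)} {c d e : List Y}

theorem refl (c : List Y) : ChainHomotopic 𝒰 c c := Relation.ReflTransGen.refl

theorem trans (h : ChainHomotopic 𝒰 c d) (h' : ChainHomotopic 𝒰 d e) : ChainHomotopic 𝒰 c e :=
  Relation.ReflTransGen.trans h h'

theorem symm (h : ChainHomotopic 𝒰 c d) : ChainHomotopic 𝒰 d c := by
  have : Std.Symm (ChainStep 𝒰) := by
    refine ⟨fun _ _ h ↦ ?_⟩
    cases h with
    | insert pre post a y b U hU ha hy hb => exact .delete pre post a y b U hU ha hy hb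
    | delete pre post a y b U hU ha hy hb => exact .insert pre post a y b U hU ha hy hb
    | dup pre post a => exact .dedup pre post a
    | dedup pre post a => exact .dup pre post a
  exact Std.Symm.symm (r := Relation.ReflTransGen (ChainStep 𝒰)) _ _ h

theorem append_right (h : ChainHomotopic 𝒰 c d) (e : List Y) :
    ChainHomotopic 𝒰 (c ++ e) (d ++ e) := by
  refine Relation.ReflTransGen.lift (· ++ e) (fun _ _ h ↦ ?_) _ _ h
  cases h with
  | insert pre post a y b U hU ha hy hb =>
    simpa [Function.onFun] using ChainStep.insert pre (post ++ e) a y b U hU ha hy hb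
  | delete pre post a y b U hU ha hy hb =>
    simpa [Function.onFun] using ChainStep.delete pre (post ++ e) a y b U hU ha hy hb
  | dup pre post a => simpa [Function.onFun] using ChainStep.dup (𝒰 := 𝒰) pre (post ++ e) a
  | dedup pre post a => simpa [Function.onFun] using ChainStep.dedup (𝒰 := 𝒰) pre (post ++ e) a

theorem append_left (h : ChainHomotopic 𝒰 c d) (e : List Y) :
    ChainHomotopic 𝒰 (e ++ c) (e ++ d) := by
  refine Relation.ReflTransGen.lift (e ++ ·) (fun _ _ h ↦ ?_) _ _ h
  cases h with
  | insert pre post a y b U hU ha hy hb =>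
    simpa using ChainStep.insert (e ++ pre) post a y b U hU ha hy hb
  | delete pre post a y b U hU ha hy hb =>
    simpa using ChainStep.delete (e ++ pre) post a y b U hU ha hy hb
  | dup pre post a => simpa using ChainStep.dup (𝒰 := 𝒰) (e ++ pre) post a
  | dedup pre post a => simpa using ChainStep.dedup (𝒰 := 𝒰) (e ++ pre) post a

theorem insert_middle (c : List Y) {a y b : Y} {U : Set Y} (hU : U ∈ 𝒰)
    (ha : a ∈ U) (hy : y ∈ U) (hb : b ∈ U) :
    ChainHomotopic 𝒰 (c ++ [a, b]) (c ++ [a, y, b]) :=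
  Relation.ReflTransGen.single (.insert c [] a y b U hU ha hy hb)

theorem dup_last (c : List Y) (a : Y) : ChainHomotopic 𝒰 (c ++ [a]) (c ++ [a, a]) :=
  Relation.ReflTransGen.single (.dup c [] a)

end ChainHomotopic

/-- `e` is the tail of a `𝒰`-chain obtained by sampling `f` on `[0, s]`, so that `f 0 :: e` is
the chain itself. -/
inductive SampleTail (𝒰 : Set (Set X)) (f : unitInterval → X) : unitInterval → List X → Prop
  | zero : SampleTail 𝒰 f 0 []
  | step {s t : unitInterval} {e : List X} (h : SampleTail 𝒰 f s e) (hst : s ≤ t) (U : Set X)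
      (hU : U ∈ 𝒰) (hsub : f '' Icc s t ⊆ U) : SampleTail 𝒰 f t (e ++ [f t])

namespace SampleTail

variable {Y : Type*} {𝒰 : Set (Set Y)} {f : unitInterval → Y} {s t : unitInterval} {e e' : List Y}

theorem exists_eq_append (h : SampleTail 𝒰 f s e) : ∃ p, f 0 :: e = p ++ [f s] := by
  cases h with
  | zero => exact ⟨[], rfl⟩
  | step h => exact ⟨f 0 :: _, rfl⟩

theorem chainHomotopic_of_eq_zero (h : SampleTail 𝒰 f s e) (hs : s = 0) :
    ChainHomotopic 𝒰 (f 0 :: e) [f 0] := by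
  induction h with
  | zero => exact .refl _
  | @step s t e h hst U hU hsub ih =>
    subst hs
    have h0 : s = 0 := le_antisymm hst bot_le
    exact ((ih h0).append_right [f 0]).trans (ChainHomotopic.dup_last [] (f 0)).symm

theorem chainHomotopic_step {r : unitInterval} {U : Set Y} (h : SampleTail 𝒰 f r e) (hrs : r ≤ s)
    (hst : s ≤ t) (hU : U ∈ 𝒰) (hsub : f '' Icc r t ⊆ U)
    (hc : ChainHomotopic 𝒰 (f 0 :: (e ++ [f s])) (f 0 :: e')) :
    ChainHomotopic 𝒰 (f 0 :: (e ++ [f t])) (f 0 :: (e' ++ [f t])) := by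
  obtain ⟨p, hp⟩ := h.exists_eq_append
  refine ChainHomotopic.trans ?_ (hc.append_right [f t])
  rw [← List.cons_append, ← List.cons_append, hp]
  simpa using ChainHomotopic.insert_middle p hU (hsub ⟨r, ⟨le_rfl, hrs.trans hst⟩, rfl⟩)
    (hsub ⟨s, ⟨hrs, hst⟩, rfl⟩) (hsub ⟨t, ⟨hrs.trans hst, le_rfl⟩, rfl⟩)

/-- Any two samplings of the same function are chain homotopic. -/
theorem chainHomotopic (h : SampleTail 𝒰 f s e) (h' : SampleTail 𝒰 f s e') :
    ChainHomotopic 𝒰 (f 0 :: e) (f 0 :: e') := by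
  induction hn : e.length + e'.length using Nat.strong_induction_on generalizing s e e' with
  | _ n ih =>
    cases h with
    | zero => exact (h'.chainHomotopic_of_eq_zero rfl).symm
    | @step r _ c h hr U hU hsub =>
      cases h' with
      | zero => exact (h.step hr U hU hsub).chainHomotopic_of_eq_zero rfl
      | @step r' _ c' h' hr' U' hU' hsub' =>
        simp only [List.length_append, List.length_singleton] at hn
        rcases le_total r r' with hle | hle
        · refine h.chainHomotopic_step hle hr' hU hsub (ih _ ?_
            (h.step hle U hU ((image_mono (Icc_subset_Icc_right hr')).trans hsub)) h' rfl)
          simp; omega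
        · refine (h'.chainHomotopic_step hle hr hU' hsub' (ih _ ?_
            (h'.step hle U' hU' ((image_mono (Icc_subset_Icc_right hr)).trans hsub')) h rfl)).symm
          simp; omega

theorem reparam {g : unitInterval → Y} {φ : unitInterval → unitInterval} (hφ : Monotone φ)
    (hφc : Continuous φ) (hfg : ∀ t, g (φ t) = f t) (h : SampleTail 𝒰 f s e)
    (h' : SampleTail 𝒰 g (φ 0) e') : SampleTail 𝒰 g (φ s) (e' ++ e) := by
  induction h with
  | zero => simpa using h'
  | @step s t e h hst U hU hsub ih =>
    rw [← hfg, ← List.append_assoc]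
    refine ih.step (hφ hst) U hU ?_
    rintro _ ⟨u, hu, rfl⟩
    obtain ⟨v, hv, rfl⟩ := intermediate_value_Icc hst hφc.continuousOn hu
    exact hsub ⟨v, hv, (hfg v).symm⟩

theorem of_seq {t : ℕ → unitInterval} (ht : Monotone t) (h0 : t 0 = 0) (n : ℕ)
    (hf : ∀ i < n, ∃ U ∈ 𝒰, f '' Icc (t i) (t (i + 1)) ⊆ U) :
    SampleTail 𝒰 f (t n) ((List.range n).map fun i ↦ f (t (i + 1))) := by
  induction n with
  | zero => simpa [h0] using zero
  | succ n ih =>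
    obtain ⟨U, hU, hsub⟩ := hf n n.lt_succ_self
    simpa [List.range_succ] using
      (ih fun i hi ↦ hf i (hi.trans n.lt_succ_self)).step (ht n.le_succ) U hU hsub

end SampleTail

theorem SampleTail.trans {𝒰 : Set (Set X)} {x y z : X} {β : Path x y} {γ : Path y z}
    {e e' : List X} (h : SampleTail 𝒰 β 1 e) (h' : SampleTail 𝒰 γ 1 e') :
    SampleTail 𝒰 (β.trans γ) 1 (e ++ e') := by
  let φ : unitInterval → unitInterval := fun t ↦ ⟨t / 2, by grind, by grind⟩
  let ψ : unitInterval → unitInterval := fun t ↦ ⟨(1 + t) / 2, by grind, by grind⟩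
  have hφ : Monotone φ := fun a b hab ↦ by
    have : (a : ℝ) ≤ b := hab
    exact Subtype.mk_le_mk.2 (by linarith)
  have hψ : Monotone ψ := fun a b hab ↦ by
    have : (a : ℝ) ≤ b := hab
    exact Subtype.mk_le_mk.2 (by linarith)
  have h0 : φ 0 = 0 := by simp [φ]
  have h1 : φ 1 = ψ 0 := by simp [φ, ψ]
  have h2 : ψ 1 = 1 := by simp [ψ]
  rw [← h2]
  refine h'.reparam hψ (by fun_prop) (fun t ↦ ?_) ?_
  · rw [Path.trans_apply]
    split_ifs with ht
    · have ht0 : t = 0 := Subtype.ext (le_antisymm (by simp [ψ] at ht ⊢; linarith) t.2.1)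
      subst ht0
      simp [ψ]
    · congr 1
      ext
      simp [ψ]
      ring
  · rw [← h1]
    refine List.nil_append e ▸ h.reparam hφ (by fun_prop) (fun t ↦ ?_) (by rw [h0]; exact .zero)
    rw [Path.trans_apply, dif_pos (by simp [φ]; linarith [t.2.2])]
    congr 1
    ext
    simp [φ]
    ring

theorem Samples.exists_sampleTail {𝒰 : Set (Set X)} {x y : X} {β : Path x y} {c : List X}
    (h : Samples 𝒰 β c) : ∃ e, c = x :: e ∧ SampleTail 𝒰 β 1 e := by
  obtain ⟨n, t, ht, h0, h1, hf, rfl⟩ := h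
  refine ⟨List.ofFn fun i : Fin n ↦ β (t i.succ), by simp [List.ofFn_succ, h0], ?_⟩
  have key : ∀ (n : ℕ) (t : Fin (n + 1) → unitInterval), Monotone t → t 0 = 0 →
      (∀ i : Fin n, ∃ U ∈ 𝒰, β '' Icc (t i.castSucc) (t i.succ) ⊆ U) →
      SampleTail 𝒰 β (t (Fin.last n)) (List.ofFn fun i : Fin n ↦ β (t i.succ)) := by
    intro n
    induction n with
    | zero => intro t _ h0 _; simpa [h0] using SampleTail.zero
    | succ n ih =>
      intro t ht h0 hf
      obtain ⟨U, hU, hsub⟩ := hf (Fin.last n)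
      rw [List.ofFn_succ_last]
      exact (ih (fun i ↦ t i.castSucc) (fun _ _ h ↦ ht h) h0 fun i ↦ hf i.castSucc).step
        (ht (Fin.le_last _)) U hU hsub
  exact h1 ▸ key n t ht h0 hf

/-- Two paths with the same endpoints have chain homotopic samplings. -/
def SampleHomotopic (𝒰 : Set (Set X)) {x y : X} (β γ : Path x y) : Prop :=
  ∃ e e', SampleTail 𝒰 β 1 e ∧ SampleTail 𝒰 γ 1 e' ∧ ChainHomotopic 𝒰 (x :: e) (x :: e')

namespace SampleHomotopic

variable {𝒰 : Set (Set X)} {x y z : X}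

theorem symm {β γ : Path x y} (h : SampleHomotopic 𝒰 β γ) : SampleHomotopic 𝒰 γ β :=
  let ⟨e, e', h, h', hc⟩ := h
  ⟨e', e, h', h, hc.symm⟩

theorem chainHomotopic {β γ : Path x y} (h : SampleHomotopic 𝒰 β γ) {c d : List X}
    (hc : SampleTail 𝒰 β 1 c) (hd : SampleTail 𝒰 γ 1 d) :
    ChainHomotopic 𝒰 (x :: c) (x :: d) := by
  obtain ⟨e, e', he, he', hee'⟩ := h
  have h₁ := hc.chainHomotopic he
  have h₂ := he'.chainHomotopic hd
  rw [Path.source] at h₁ h₂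
  exact h₁.trans (hee'.trans h₂)

theorem trans {β γ δ : Path x y} (h : SampleHomotopic 𝒰 β γ) (h' : SampleHomotopic 𝒰 γ δ) :
    SampleHomotopic 𝒰 β δ := by
  obtain ⟨e, e', he, he', hc⟩ := h
  obtain ⟨d, d', hd, hd', hc'⟩ := h'
  exact ⟨e, d', he, hd', hc.trans (chainHomotopic ⟨d, d', hd, hd', hc'⟩ he' hd')⟩

theorem hcomp {β β' : Path x y} {γ γ' : Path y z} (h : SampleHomotopic 𝒰 β β')
    (h' : SampleHomotopic 𝒰 γ γ') : SampleHomotopic 𝒰 (β.trans γ) (β'.trans γ') := by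
  obtain ⟨e, e', he, he', hc⟩ := h
  obtain ⟨d, d', hd, hd', hc'⟩ := h'
  refine ⟨e ++ d, e' ++ d', he.trans hd, he'.trans hd', ?_⟩
  obtain ⟨p, hp⟩ := he'.exists_eq_append
  rw [Path.source, Path.target] at hp
  refine (hc.append_right d).trans ?_
  rw [← List.cons_append, hp]
  simpa using hc'.append_left p

theorem of_range_subset {β γ : Path x y} {U : Set X} (hU : U ∈ 𝒰) (hβ : range β ⊆ U)
    (hγ : range γ ⊆ U) : SampleHomotopic 𝒰 β γ := by
  refine ⟨_, _, SampleTail.zero.step zero_le_one U hU ((image_subset_range _ _).trans hβ),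
    SampleTail.zero.step zero_le_one U hU ((image_subset_range _ _).trans hγ), ?_⟩
  simpa using ChainHomotopic.refl _

/-- Homotopic paths have chain homotopic samplings. -/
theorem of_homotopic (h𝒰 : IsOpenCover 𝒰) {β γ : Path x y} (h : β.Homotopic γ) :
    SampleHomotopic 𝒰 β γ := by
  obtain ⟨H⟩ := h
  obtain ⟨t, h0, ht, ⟨n, hn⟩, hgrid⟩ :=
    exists_monotone_Icc_subset_open_cover_unitInterval_prod_self
      (c := fun U : 𝒰 ↦ H ⁻¹' (U : Set X)) (fun U ↦ (h𝒰.1 U U.2).preimage H.continuous)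
      (fun p _ ↦ by
        obtain ⟨U, hU, hp⟩ : H p ∈ ⋃₀ 𝒰 := h𝒰.2 ▸ mem_univ _
        exact mem_iUnion.2 ⟨⟨U, hU⟩, hp⟩)
  have hsq : ∀ j i, ∃ U ∈ 𝒰, ∀ u ∈ Icc (t j) (t (j + 1)), ∀ v ∈ Icc (t i) (t (i + 1)),
      H (u, v) ∈ U := fun j i ↦ by
    obtain ⟨U, hU⟩ := hgrid j i
    exact ⟨U, U.2, fun u hu v hv ↦ hU ⟨hu, hv⟩⟩
  have mem_left (j) : t j ∈ Icc (t j) (t (j + 1)) := ⟨le_rfl, ht j.le_succ⟩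
  have mem_right (j) : t (j + 1) ∈ Icc (t j) (t (j + 1)) := ⟨ht j.le_succ, le_rfl⟩
  let tail (j i : ℕ) : List X := (List.range i).map fun i ↦ H (t j, t (i + 1))
  have tail_succ (j i) : tail j (i + 1) = tail j i ++ [H (t j, t (i + 1))] := by
    simp [tail, List.range_succ]
  have htail (j i) : SampleTail 𝒰 (H.eval (t j)) (t i) (tail j i) :=
    SampleTail.of_seq ht h0 i fun i _ ↦ by
      obtain ⟨U, hU, hsub⟩ := hsq j i
      refine ⟨U, hU, ?_⟩
      rintro _ ⟨v, hv, rfl⟩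
      exact hsub _ (mem_left j) v hv
  have hlast (j i) : ∃ p, x :: tail j i = p ++ [H (t j, t i)] := by
    simpa using (htail j i).exists_eq_append
  have hladder (j i) : ChainHomotopic 𝒰 (x :: (tail j i ++ [H (t (j + 1), t i)]))
      (x :: tail (j + 1) i) := by
    induction i with
    | zero => simpa [tail, h0] using (ChainHomotopic.dup_last (𝒰 := 𝒰) [] x).symm
    | succ i ih =>
      obtain ⟨U, hU, hsub⟩ := hsq j i
      obtain ⟨p, hp⟩ := hlast j i
      rw [tail_succ, tail_succ]
      refine ChainHomotopic.trans ?_ (ih.append_right [H (t (j + 1), t (i + 1))])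
      rw [List.append_assoc, ← List.cons_append, ← List.cons_append, hp]
      have h₁ := ChainHomotopic.insert_middle p hU (hsub _ (mem_left j) _ (mem_left i))
        (hsub _ (mem_left j) _ (mem_right i)) (hsub _ (mem_right j) _ (mem_right i))
      have h₂ := ChainHomotopic.insert_middle p hU (hsub _ (mem_left j) _ (mem_left i))
        (hsub _ (mem_right j) _ (mem_left i)) (hsub _ (mem_right j) _ (mem_right i))
      simpa using h₁.symm.trans h₂
  have hn1 : t n = 1 := hn n le_rfl
  have hrow (j) : SampleHomotopic 𝒰 (H.eval (t j)) (H.eval (t (j + 1))) := by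
    refine ⟨tail j n, tail (j + 1) n, hn1 ▸ htail j n, hn1 ▸ htail (j + 1) n, ?_⟩
    refine ChainHomotopic.trans ?_ (hladder j n)
    obtain ⟨p, hp⟩ := hlast j n
    rw [← List.cons_append, hp]
    simpa [hn1] using ChainHomotopic.dup_last p y
  have hrows (j) : SampleHomotopic 𝒰 (H.eval (t 0)) (H.eval (t j)) := by
    induction j with
    | zero => exact (hrow 0).trans (hrow 0).symm
    | succ j ih => exact ih.trans (hrow j)
  simpa [h0, hn1] using hrows n

theorem refl (h𝒰 : IsOpenCover 𝒰) (β : Path x y) : SampleHomotopic 𝒰 β β :=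
  of_homotopic h𝒰 (.refl β)

theorem symm_of_refl (h𝒰 : IsOpenCover 𝒰) {β : Path x x}
    (h : SampleHomotopic 𝒰 β (.refl x)) : SampleHomotopic 𝒰 β.symm (.refl x) :=
  ((of_homotopic h𝒰 (Path.Homotopic.trans_refl β.symm).symm).trans
    ((refl h𝒰 β.symm).hcomp h.symm)).trans (of_homotopic h𝒰 (Path.Homotopic.symm_trans β))

theorem conj_of_range_subset (h𝒰 : IsOpenCover 𝒰) (α : Path x y) {γ : Path y y} {U : Set X}
    (hU : U ∈ 𝒰) (hγ : range γ ⊆ U) :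
    SampleHomotopic 𝒰 ((α.trans γ).trans α.symm) (.refl x) := by
  have hy : range (Path.refl y) ⊆ U := by
    rintro _ ⟨_, rfl⟩
    exact hγ ⟨0, γ.source⟩
  refine (((refl h𝒰 α).hcomp (of_range_subset hU hγ hy)).hcomp (refl h𝒰 α.symm)).trans ?_
  exact of_homotopic h𝒰
    (((Path.Homotopic.trans_refl α).hcomp (.refl α.symm)).trans (Path.Homotopic.trans_symm α))

end SampleHomotopic

theorem loopClass_eq_iff {x : X} {β γ : Path x x} : loopClass β = loopClass γ ↔ β.Homotopic γ :=
  Path.Homotopic.Quotient.eq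

theorem loopClass_surjective (x : X) : Function.Surjective (loopClass (x := x)) :=
  Path.Homotopic.Quotient.mk_surjective

theorem loopClass_mul {x : X} (β γ : Path x x) :
    loopClass β * loopClass γ = loopClass (γ.trans β) := rfl

theorem loopClass_inv {x : X} (β : Path x x) : (loopClass β)⁻¹ = loopClass β.symm := rfl

theorem loopClass_refl (x : X) : loopClass (Path.refl x) = 1 := rfl

theorem sampleHomotopic_refl_of_mem_piCover {𝒰 : Set (Set X)} (h𝒰 : IsOpenCover 𝒰) {x : X}
    {β : Path x x} (h : loopClass β ∈ piCover 𝒰 x) : SampleHomotopic 𝒰 β (.refl x) := by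
  suffices ∃ γ, loopClass β = loopClass γ ∧ SampleHomotopic 𝒰 γ (.refl x) by
    obtain ⟨γ, hβγ, hγ⟩ := this
    exact (SampleHomotopic.of_homotopic h𝒰 (loopClass_eq_iff.1 hβγ)).trans hγ
  generalize loopClass β = g at h
  induction h using Subgroup.closure_induction with
  | mem g hg =>
    obtain ⟨y, α, γ, U, hU, hγ, rfl⟩ := hg
    exact ⟨_, rfl, .conj_of_range_subset h𝒰 α hU hγ⟩
  | one => exact ⟨_, (loopClass_refl x).symm, .refl h𝒰 _⟩
  | mul g g' _ _ hg hg' =>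
    obtain ⟨γ, rfl, hγ⟩ := hg
    obtain ⟨γ', rfl, hγ'⟩ := hg'
    exact ⟨_, loopClass_mul γ γ', (hγ'.hcomp hγ).trans
      (.of_homotopic h𝒰 (Path.Homotopic.trans_refl _))⟩
  | inv g _ hg =>
    obtain ⟨γ, rfl, hγ⟩ := hg
    exact ⟨_, loopClass_inv γ, hγ.symm_of_refl h𝒰⟩

/-- If the class of a loop `β` at `x₀` lies in `π(𝒰, x₀)`, then the image of `β` in the
edge-path group of the Rips complex `R(X, 𝒰)` is trivial: every `𝒰`-chain sampling of `β`
is `𝒰`-homotopic to the constant chain at `x₀`. -/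
theorem sample_chain_null_of_mem_piCover (𝒰 : Set (Set X)) (h𝒰 : IsOpenCover 𝒰)
    (x₀ : X) (β : Path x₀ x₀) (h : loopClass β ∈ piCover 𝒰 x₀) :
    ∀ c : List X, Samples 𝒰 β c → ChainHomotopic 𝒰 c [x₀] := by
  intro c hc
  obtain ⟨e, rfl, he⟩ := hc.exists_sampleTail
  have hconst : SampleTail 𝒰 (Path.refl x₀) 0 [] := .zero
  obtain ⟨U, hU, hx⟩ : x₀ ∈ ⋃₀ 𝒰 := h𝒰.2 ▸ mem_univ _
  have hone := hconst.step zero_le_one U hU (by rintro _ ⟨_, _, rfl⟩; exact hx)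
  exact ((sampleHomotopic_refl_of_mem_piCover h𝒰 h).chainHomotopic he hone).trans
    (ChainHomotopic.dup_last [] x₀).symm
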